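/- arXiv:1704.02505 — 4 statements merged into one kernel-verified Lean document; each statement's English description precedes it below -/
import Mathlib

section
/- Let γ denote the standard Gaussian measure on ℝ and N(u) := γ((−∞, u]) its cumulative distribution function. Let x > 0, K > 0, β > 0, τ > 0 and m ∈ ℝ, and set d± := (ln(x/K) + (m ± β²/2)τ) / (β√τ). Then ∫_ℝ max(K − x·exp((m − β²/2)τ + β√τ·y), 0) dγ(y) = K·N(−d₋) − x·e^{mτ}·N(−d₊). -/
open MeasureTheory ProbabilityTheory

lemma aux_exp (s a : ℝ) :
    ∫ y, (Set.Iic a).indicator (fun y => Real.exp (s * y)) y ∂(gaussianReal 0 1)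
      = Real.exp (s ^ 2 / 2) * ((gaussianReal 0 1) (Set.Iic (a - s))).toReal := by
  have h1 : ((gaussianReal 0 1) (Set.Iic (a - s))).toReal
      = ∫ y, (Set.Iic (a - s)).indicator (fun _ => (1 : ℝ)) y ∂(gaussianReal 0 1) := by
    rw [integral_indicator_const _ measurableSet_Iic]
    simp [Measure.real]
  rw [h1, integral_gaussianReal_eq_integral_smul one_ne_zero,
    integral_gaussianReal_eq_integral_smul one_ne_zero, ← integral_const_mul,
    ← integral_sub_right_eq_self
      (fun y => Real.exp (s ^ 2 / 2) * (gaussianPDFReal 0 1 y •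
        (Set.Iic (a - s)).indicator (fun _ => (1 : ℝ)) y)) s]
  congr 1
  ext y
  by_cases hy : y ≤ a
  · have h2 : y - s ≤ a - s := by linarith
    rw [Set.indicator_of_mem (Set.mem_Iic.2 hy), Set.indicator_of_mem (Set.mem_Iic.2 h2)]
    simp only [gaussianPDFReal, smul_eq_mul, NNReal.coe_one, mul_one]
    rw [mul_left_comm, mul_assoc, ← Real.exp_add, ← Real.exp_add]
    congr 2
    ring
  · have h2 : ¬ y - s ≤ a - s := by intro h; apply hy; linarith
    rw [Set.indicator_of_notMem (by simpa using hy), Set.indicator_of_notMem (by simpa using hy)]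
    simp

theorem stmt13 (K x β τ m : ℝ) (hK : 0 < K) (hx : 0 < x) (hβ : 0 < β) (hτ : 0 < τ)
    (N : ℝ → ℝ)
    (hN : ∀ u : ℝ, N u = ((gaussianReal 0 1) (Set.Iic u)).toReal)
    (dplus dminus : ℝ)
    (hdp : dplus = (Real.log (x / K) + (m + β ^ 2 / 2) * τ) / (β * Real.sqrt τ))
    (hdm : dminus = (Real.log (x / K) + (m - β ^ 2 / 2) * τ) / (β * Real.sqrt τ)) :
    ∫ y, max (K - x * Real.exp ((m - β ^ 2 / 2) * τ + β * Real.sqrt τ * y)) 0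
        ∂(gaussianReal 0 1)
      = K * N (-dminus) - x * Real.exp (m * τ) * N (-dplus) := by
  have hq : 0 < Real.sqrt τ := Real.sqrt_pos.2 hτ
  have hqq : Real.sqrt τ ^ 2 = τ := Real.sq_sqrt hτ.le
  obtain ⟨s, hs⟩ : ∃ s, s = β * Real.sqrt τ := ⟨_, rfl⟩
  have hs0 : 0 < s := by rw [hs]; positivity
  have hs2 : s ^ 2 = β ^ 2 * τ := by rw [hs, mul_pow, hqq]
  rw [← hs] at hdp hdm ⊢
  have hd : -dplus = -dminus - s := by
    rw [hdp, hdm]; field_simp; rw [hs2]; ring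
  have hds : dminus * s = Real.log x - Real.log K + (m - β ^ 2 / 2) * τ := by
    rw [hdm, ← Real.log_div hx.ne' hK.ne']; field_simp
  have key : ∀ y, max (K - x * Real.exp ((m - β ^ 2 / 2) * τ + s * y)) 0
      = K * (Set.Iic (-dminus)).indicator (fun _ => (1 : ℝ)) y
        - x * Real.exp ((m - β ^ 2 / 2) * τ) *
          (Set.Iic (-dminus)).indicator (fun y => Real.exp (s * y)) y := by
    intro y
    have e1 : x * Real.exp ((m - β ^ 2 / 2) * τ + s * y)
        = Real.exp (Real.log K + (dminus + y) * s) := by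
      conv_lhs => rw [← Real.exp_log hx]
      rw [← Real.exp_add]
      congr 1
      linarith
    by_cases hy : y ≤ -dminus
    · rw [Set.indicator_of_mem (Set.mem_Iic.2 hy), Set.indicator_of_mem (Set.mem_Iic.2 hy),
        max_eq_left, Real.exp_add]
      · ring
      · rw [e1, sub_nonneg]
        conv_rhs => rw [← Real.exp_log hK]
        apply Real.exp_le_exp.2
        nlinarith
    · rw [Set.indicator_of_notMem (by simpa using hy),
        Set.indicator_of_notMem (by simpa using hy), max_eq_right]
      · ring
      · rw [e1, sub_nonpos]
        conv_lhs => rw [← Real.exp_log hK]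
        apply Real.exp_le_exp.2
        nlinarith
  simp_rw [key]
  rw [integral_sub, integral_const_mul, integral_const_mul, aux_exp,
    integral_indicator_const _ measurableSet_Iic, hN, hN, hd]
  · have : Real.exp (m * τ) = Real.exp ((m - β ^ 2 / 2) * τ) * Real.exp (s ^ 2 / 2) := by
      rw [← Real.exp_add, hs2]; congr 1; ring
    rw [this]
    simp only [Measure.real, smul_eq_mul]
    ring
  · exact ((integrable_const _).indicator measurableSet_Iic).const_mul _
  · exact ((integrable_exp_mul_gaussianReal s).indicator measurableSet_Iic).const_mul _
end

section
/- Fix K > 0, β > 0, m ∈ ℝ and T > 0. Define v : [0,T) × (0,∞) → ℝ by v(t,x) := K·N(−d₋(t,x)) − x·e^{m(T−t)}·N(−d₊(t,x)), where d±(t,x) := (ln(x/K) + (m ± β²/2)(T−t)) / (β√(T−t)) and N is the standard normal cumulative distribution function. Then v is twice continuously differentiable in x and once in t on [0,T) × (0,∞), and it satisfies the partial differential equation ∂v/∂t (t,x) + m·x·∂v/∂x (t,x) + (β²/2)·x²·∂²v/∂x² (t,x) = 0 for all (t,x) ∈ [0,T) × (0,∞). -/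
theorem hasDerivAt_N_aux (N : ℝ → ℝ)
    (hN : ∀ u : ℝ, N u = ∫ y in Set.Iic u, (Real.sqrt (2 * Real.pi))⁻¹ * Real.exp (-y ^ 2 / 2))
    (u : ℝ) : HasDerivAt N ((Real.sqrt (2 * Real.pi))⁻¹ * Real.exp (-u ^ 2 / 2)) u := by
  have hc : Continuous (fun y : ℝ => (Real.sqrt (2 * Real.pi))⁻¹ * Real.exp (-y ^ 2 / 2)) := by
    fun_prop
  have hi : MeasureTheory.Integrable
      (fun y : ℝ => (Real.sqrt (2 * Real.pi))⁻¹ * Real.exp (-y ^ 2 / 2)) := by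
    have := (integrable_exp_neg_mul_sq (b := 1/2) (by norm_num)).const_mul
      (Real.sqrt (2 * Real.pi))⁻¹
    refine this.congr (Filter.Eventually.of_forall fun y => ?_)
    simp only
    congr 2
    ring
  have h1 : N = fun u => N 0 + ∫ y in (0:ℝ)..u,
      (Real.sqrt (2 * Real.pi))⁻¹ * Real.exp (-y ^ 2 / 2) := by
    funext w
    rw [hN w, hN 0, ← intervalIntegral.integral_Iic_sub_Iic hi.integrableOn hi.integrableOn]
    ring
  rw [h1]
  exact (intervalIntegral.integral_hasDerivAt_right (hc.intervalIntegrable _ _)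
    (hc.stronglyMeasurableAtFilter _ _) hc.continuousAt).const_add _

theorem stmt14 (K β m T : ℝ) (hK : 0 < K) (hβ : 0 < β) (hT : 0 < T)
    (N : ℝ → ℝ)
    (hN : ∀ u : ℝ, N u = ∫ y in Set.Iic u, (Real.sqrt (2 * Real.pi))⁻¹ * Real.exp (-y ^ 2 / 2))
    (dp dm : ℝ → ℝ → ℝ)
    (hdp : ∀ t x, dp t x = (Real.log (x / K) + (m + β ^ 2 / 2) * (T - t)) / (β * Real.sqrt (T - t)))
    (hdm : ∀ t x, dm t x = (Real.log (x / K) + (m - β ^ 2 / 2) * (T - t)) / (β * Real.sqrt (T - t)))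
    (v : ℝ → ℝ → ℝ)
    (hv : ∀ t x, v t x = K * N (-(dm t x)) - x * Real.exp (m * (T - t)) * N (-(dp t x))) :
    (∀ t ∈ Set.Ico (0 : ℝ) T, ∀ x ∈ Set.Ioi (0 : ℝ),
      HasDerivAt (fun s => v s x) (deriv (fun s => v s x) t) t ∧
      HasDerivAt (fun y => v t y) (deriv (fun y => v t y) x) x ∧
      HasDerivAt (fun y => deriv (fun y' => v t y') y) (deriv (deriv (fun y' => v t y')) x) x ∧
      deriv (fun s => v s x) t + m * x * deriv (fun y => v t y) x
        + β ^ 2 / 2 * x ^ 2 * deriv (deriv (fun y' => v t y')) x = 0) ∧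
    ContinuousOn (fun p : ℝ × ℝ => v p.1 p.2) (Set.Ico 0 T ×ˢ Set.Ioi 0) ∧
    ContinuousOn (fun p : ℝ × ℝ => deriv (fun s => v s p.2) p.1) (Set.Ico 0 T ×ˢ Set.Ioi 0) ∧
    ContinuousOn (fun p : ℝ × ℝ => deriv (fun y => v p.1 y) p.2) (Set.Ico 0 T ×ˢ Set.Ioi 0) ∧
    ContinuousOn (fun p : ℝ × ℝ => deriv (deriv (fun y => v p.1 y)) p.2)
      (Set.Ico 0 T ×ˢ Set.Ioi 0) := by
  have hND := hasDerivAt_N_aux N hN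
  obtain ⟨φ, hφ⟩ : ∃ φ : ℝ → ℝ, φ = fun u => (Real.sqrt (2 * Real.pi))⁻¹ * Real.exp (-u ^ 2 / 2) :=
    ⟨_, rfl⟩
  have hφN : ∀ u, HasDerivAt N (φ u) u := by intro u; rw [hφ]; exact hND u
  have hφc : Continuous φ := by rw [hφ]; fun_prop
  have hNc : Continuous N := continuous_iff_continuousAt.2 fun u => (hφN u).continuousAt
  have hrel : ∀ t x, t < T → dm t x = dp t x - β * Real.sqrt (T - t) := by
    intro t x ht
    have hs : 0 < Real.sqrt (T - t) := Real.sqrt_pos.2 (by linarith)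
    have hsq : Real.sqrt (T - t) ^ 2 = T - t := Real.sq_sqrt (by linarith)
    rw [hdm, hdp]
    set s := Real.sqrt (T - t)
    rw [← hsq]
    field_simp
    ring
  have hkey : ∀ t x, t < T → 0 < x →
      K * φ (-(dm t x)) = x * Real.exp (m * (T - t)) * φ (-(dp t x)) := by
    intro t x ht hx
    have hs : 0 < Real.sqrt (T - t) := Real.sqrt_pos.2 (by linarith)
    have hsq : Real.sqrt (T - t) ^ 2 = T - t := Real.sq_sqrt (by linarith)
    have hd : dp t x * (β * Real.sqrt (T - t)) =
        Real.log (x / K) + (m + β ^ 2 / 2) * (T - t) := by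
      rw [hdp]; field_simp
    have hx' : x = K * Real.exp (Real.log (x / K)) := by
      rw [Real.exp_log (by positivity)]; field_simp
    have he : Real.exp (-(-(dm t x)) ^ 2 / 2) =
        Real.exp (Real.log (x / K)) * Real.exp (m * (T - t)) * Real.exp (-(-(dp t x)) ^ 2 / 2) := by
      rw [← Real.exp_add, ← Real.exp_add]
      congr 1
      rw [hrel t x ht]
      have : Real.log (x / K) = dp t x * (β * Real.sqrt (T - t)) - (m + β ^ 2 / 2) * (T - t) := by
        linarith
      rw [this]
      linear_combination (-(β ^ 2) / 2) * hsq
    simp only [hφ]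
    rw [he]
    linear_combination (-((Real.sqrt (2 * Real.pi))⁻¹ * Real.exp (m * (T - t)) *
      Real.exp (-(-(dp t x)) ^ 2 / 2))) * hx'
  -- derivative of dp in x
  have hdpx : ∀ t x, t < T → 0 < x →
      HasDerivAt (fun y => dp t y) (1 / (x * (β * Real.sqrt (T - t)))) x := by
    intro t x ht hx
    have hs : 0 < Real.sqrt (T - t) := Real.sqrt_pos.2 (by linarith)
    have h1 : HasDerivAt (fun y : ℝ => Real.log (y / K)) ((1 / K) / (x / K)) x :=
      ((hasDerivAt_id x).div_const K).log (by simp only [id]; positivity)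
    have h2 := (h1.add_const ((m + β ^ 2 / 2) * (T - t))).div_const (β * Real.sqrt (T - t))
    have h3 : (fun y => dp t y) = fun y => (Real.log (y / K) + (m + β ^ 2 / 2) * (T - t)) / (β * Real.sqrt (T - t)) :=
      funext fun y => hdp t y
    rw [h3]
    refine h2.congr_deriv ?_
    field_simp
  have hsqt : ∀ t, t < T →
      HasDerivAt (fun s => Real.sqrt (T - s)) (-1 / (2 * Real.sqrt (T - t))) t := by
    intro t ht
    exact ((hasDerivAt_id t).const_sub T).sqrt (by simp only [id]; linarith)
  have hdpt : ∀ t x, t < T → 0 < x → ∃ D, HasDerivAt (fun s => dp s x) D t := by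
    intro t x ht hx
    have hs : 0 < Real.sqrt (T - t) := Real.sqrt_pos.2 (by linarith)
    have h3 : (fun s => dp s x) = fun s => (Real.log (x / K) + (m + β ^ 2 / 2) * (T - s)) / (β * Real.sqrt (T - s)) :=
      funext fun s => hdp s x
    rw [h3]
    exact ⟨_, ((((hasDerivAt_id t).const_sub T).const_mul (m + β ^ 2 / 2)).const_add
      (Real.log (x / K))).div ((hsqt t ht).const_mul β) (by positivity)⟩
  have hvx : ∀ t x, t < T → 0 < x →
      HasDerivAt (fun y => v t y) (-(Real.exp (m * (T - t)) * N (-(dp t x)))) x := by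
    intro t x ht hx
    have hP := hdpx t x ht hx
    have hM : HasDerivAt (fun y => dm t y) (1 / (x * (β * Real.sqrt (T - t)))) x := by
      have h3 : (fun y => dm t y) = fun y => dp t y - β * Real.sqrt (T - t) :=
        funext fun y => hrel t y ht
      rw [h3]
      exact hP.sub_const _
    have h1 := ((hφN (-(dm t x))).comp x hM.neg).const_mul K
    have h2 := ((hasDerivAt_id x).mul_const (Real.exp (m * (T - t)))).mul
      ((hφN (-(dp t x))).comp x hP.neg)
    have h4 : (fun y => v t y) = fun y => K * N (-(dm t y)) - y * Real.exp (m * (T - t)) * N (-(dp t y)) :=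
      funext fun y => hv t y
    rw [h4]
    refine (h1.sub h2).congr_deriv ?_
    have := hkey t x ht hx
    simp only [id, Function.comp]
    linear_combination (-(1 / (x * (β * Real.sqrt (T - t))))) * this
  have hvt : ∀ t x, t < T → 0 < x →
      HasDerivAt (fun s => v s x) (m * x * Real.exp (m * (T - t)) * N (-(dp t x))
        - x * Real.exp (m * (T - t)) * φ (-(dp t x)) * (β / (2 * Real.sqrt (T - t)))) t := by
    intro t x ht hx
    obtain ⟨D, hP⟩ := hdpt t x ht hx
    have hM : HasDerivAt (fun s => dm s x) (D - β * (-1 / (2 * Real.sqrt (T - t)))) t := by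
      refine (hP.sub ((hsqt t ht).const_mul β)).congr_of_eventuallyEq ?_
      filter_upwards [Iio_mem_nhds ht] with s hs
      exact hrel s x hs
    have h1 := ((hφN (-(dm t x))).comp t hM.neg).const_mul K
    have hE : HasDerivAt (fun s => x * Real.exp (m * (T - s)))
        (x * (Real.exp (m * (T - t)) * (m * (-1)))) t :=
      ((((hasDerivAt_id t).const_sub T).const_mul m).exp).const_mul x
    have h2 := hE.mul ((hφN (-(dp t x))).comp t hP.neg)
    have h4 : (fun s => v s x) = fun s => K * N (-(dm s x)) - x * Real.exp (m * (T - s)) * N (-(dp s x)) :=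
      funext fun s => hv s x
    rw [h4]
    refine (h1.sub h2).congr_deriv ?_
    have := hkey t x ht hx
    simp only [Function.comp]
    linear_combination (-(D - β * (-1 / (2 * Real.sqrt (T - t))))) * this
  have hvxx : ∀ t x, t < T → 0 < x →
      HasDerivAt (deriv (fun y => v t y)) (Real.exp (m * (T - t)) * φ (-(dp t x)) *
        (1 / (x * (β * Real.sqrt (T - t))))) x := by
    intro t x ht hx
    have h1 := (((hφN (-(dp t x))).comp x (hdpx t x ht hx).neg).const_mul
      (Real.exp (m * (T - t)))).neg
    refine (h1.congr_of_eventuallyEq ?_).congr_deriv ?_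
    · filter_upwards [Ioi_mem_nhds hx] with y hy
      exact (hvx t y ht hy).deriv
    · ring
  have hdpc : ContinuousOn (fun p : ℝ × ℝ => dp p.1 p.2) (Set.Ico 0 T ×ˢ Set.Ioi 0) := by
    have h3 : (fun p : ℝ × ℝ => dp p.1 p.2) = fun p => (Real.log (p.2 / K) + (m + β ^ 2 / 2) * (T - p.1)) / (β * Real.sqrt (T - p.1)) :=
      funext fun p => hdp p.1 p.2
    rw [h3]
    refine ContinuousOn.div (ContinuousOn.add (ContinuousOn.log (by fun_prop) ?_) (by fun_prop))
      (by fun_prop) ?_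
    · rintro ⟨t, x⟩ ⟨_, hx⟩
      have hx : 0 < x := hx
      positivity
    · rintro ⟨t, x⟩ ⟨ht, _⟩
      have hs : 0 < Real.sqrt (T - t) := Real.sqrt_pos.2 (by have : t < T := ht.2; linarith)
      positivity
  have hNp : ContinuousOn (fun p : ℝ × ℝ => N (-(dp p.1 p.2))) (Set.Ico 0 T ×ˢ Set.Ioi 0) :=
    hNc.comp_continuousOn hdpc.neg
  have hφp : ContinuousOn (fun p : ℝ × ℝ => φ (-(dp p.1 p.2))) (Set.Ico 0 T ×ˢ Set.Ioi 0) :=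
    hφc.comp_continuousOn hdpc.neg
  have hpos : ∀ p ∈ (Set.Ico 0 T ×ˢ Set.Ioi 0 : Set (ℝ × ℝ)), p.1 < T ∧ 0 < p.2 :=
    fun p hp => ⟨hp.1.2, hp.2⟩
  have hsp : ∀ p ∈ (Set.Ico 0 T ×ˢ Set.Ioi 0 : Set (ℝ × ℝ)), 0 < Real.sqrt (T - p.1) :=
    fun p hp => Real.sqrt_pos.2 (by have := (hpos p hp).1; linarith)
  refine ⟨?_, ?_, ?_, ?_, ?_⟩
  · intro t ht x hx
    have ht : t < T := ht.2
    have hx : 0 < x := hx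
    have hs : 0 < Real.sqrt (T - t) := Real.sqrt_pos.2 (by linarith)
    have a := hvt t x ht hx
    have b := hvx t x ht hx
    have c := hvxx t x ht hx
    refine ⟨a.differentiableAt.hasDerivAt, b.differentiableAt.hasDerivAt,
      c.differentiableAt.hasDerivAt, ?_⟩
    rw [a.deriv, b.deriv, c.deriv]
    field_simp
    ring
  · have : ContinuousOn (fun p : ℝ × ℝ => K * N (-(dp p.1 p.2 - β * Real.sqrt (T - p.1))) -
        p.2 * Real.exp (m * (T - p.1)) * N (-(dp p.1 p.2))) (Set.Ico 0 T ×ˢ Set.Ioi 0) := by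
      refine ContinuousOn.sub (continuousOn_const.mul (hNc.comp_continuousOn
        (hdpc.sub (by fun_prop)).neg)) (ContinuousOn.mul (by fun_prop) hNp)
    refine this.congr fun p hp => ?_
    simp only
    rw [hv, hrel _ _ (hpos p hp).1]
  · refine ContinuousOn.congr ?_ fun p hp => (hvt p.1 p.2 (hpos p hp).1 (hpos p hp).2).deriv
    refine ContinuousOn.sub (ContinuousOn.mul (by fun_prop) hNp)
      (ContinuousOn.mul (ContinuousOn.mul (by fun_prop) hφp)
        (ContinuousOn.div (by fun_prop) (by fun_prop) fun p hp => ?_))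
    have := hsp p hp
    positivity
  · refine ContinuousOn.congr ?_ fun p hp => (hvx p.1 p.2 (hpos p hp).1 (hpos p hp).2).deriv
    exact (ContinuousOn.mul (by fun_prop) hNp).neg
  · refine ContinuousOn.congr ?_ fun p hp => (hvxx p.1 p.2 (hpos p hp).1 (hpos p hp).2).deriv
    refine ContinuousOn.mul (ContinuousOn.mul (by fun_prop) hφp)
        (ContinuousOn.div (by fun_prop) (by fun_prop) fun p hp => ?_)
    have := hsp p hp
    have := (hpos p hp).2
    positivity
end

section
/- Fix K > 0, β > 0, m ∈ ℝ and T > 0, and let v(t,x) := K·N(−d₋(t,x)) − x·e^{m(T−t)}·N(−d₊(t,x)) with d±(t,x) := (ln(x/K) + (m ± β²/2)(T−t)) / (β√(T−t)) and N the standard normal cumulative distribution function. Then for every t ∈ [0,T), the function x ↦ v(t,x) is convex on (0,∞). -/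
theorem stmt16 (K β m T : ℝ) (hK : 0 < K) (hβ : 0 < β) (hT : 0 < T)
    (N : ℝ → ℝ)
    (hN : ∀ u : ℝ, N u = ∫ y in Set.Iic u, (Real.sqrt (2 * Real.pi))⁻¹ * Real.exp (-y ^ 2 / 2))
    (dp dm : ℝ → ℝ → ℝ)
    (hdp : ∀ t x, dp t x = (Real.log (x / K) + (m + β ^ 2 / 2) * (T - t)) / (β * Real.sqrt (T - t)))
    (hdm : ∀ t x, dm t x = (Real.log (x / K) + (m - β ^ 2 / 2) * (T - t)) / (β * Real.sqrt (T - t)))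
    (v : ℝ → ℝ → ℝ)
    (hv : ∀ t x, v t x = K * N (-(dm t x)) - x * Real.exp (m * (T - t)) * N (-(dp t x))) :
    ∀ t ∈ Set.Ico (0 : ℝ) T, ConvexOn ℝ (Set.Ioi 0) (fun x => v t x) := by
  intro t ht
  set φ : ℝ → ℝ := fun y => (Real.sqrt (2 * Real.pi))⁻¹ * Real.exp (-y ^ 2 / 2) with hφ
  have hφc : Continuous φ := by rw [hφ]; fun_prop
  have hφi : MeasureTheory.Integrable φ := by
    have h := (integrable_exp_neg_mul_sq (b := 1 / 2) (by norm_num)).const_mul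
      (Real.sqrt (2 * Real.pi))⁻¹
    refine h.congr (Filter.Eventually.of_forall fun y => ?_)
    simp only [hφ]
    congr 2
    ring
  have hφ0 : ∀ y, 0 ≤ φ y := fun y => by simp only [hφ]; positivity
  have hNd : ∀ u, HasDerivAt N (φ u) u := by
    intro u
    have h1 : N = fun u => N 0 + ∫ y in (0 : ℝ)..u, φ y := by
      funext u
      have := intervalIntegral.integral_Iic_sub_Iic (f := φ) (μ := MeasureTheory.volume)
        (a := 0) (b := u) hφi.integrableOn hφi.integrableOn
      rw [← this, hN u, hN 0]
      ring
    rw [h1]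
    exact (hφc.integral_hasStrictDerivAt 0 u).hasDerivAt.const_add _
  have hNm : Monotone N := monotone_of_deriv_nonneg (fun u => (hNd u).differentiableAt)
    (fun u => by rw [(hNd u).deriv]; exact hφ0 u)
  have hτ : 0 < T - t := by linarith [ht.2]
  set τ := T - t with hτd
  have hs : 0 < β * Real.sqrt τ := by positivity
  have hs2 : (β * Real.sqrt τ) ^ 2 = β ^ 2 * τ := by
    rw [mul_pow, Real.sq_sqrt hτ.le]
  set s := β * Real.sqrt τ with hsd
  have hdd : ∀ c x : ℝ, 0 < x →
      HasDerivAt (fun x => -((Real.log (x / K) + c) / s)) (-(x⁻¹ / s)) x := by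
    intro c x hx
    have h := ((((hasDerivAt_id x).div_const K).log (by simp; exact ⟨hx.ne', hK.ne'⟩)).add_const
      c).div_const s |>.neg
    refine h.congr_deriv ?_
    simp only [id]
    field_simp
  have hV : ∀ x, 0 < x → HasDerivAt (fun x => v t x) (-(Real.exp (m * τ) * N (-(dp t x)))) x := by
    intro x hx
    have hp := (hNd _).comp x (hdd ((m + β ^ 2 / 2) * τ) x hx)
    have hm := (hNd _).comp x (hdd ((m - β ^ 2 / 2) * τ) x hx)
    have h := (hm.const_mul K).sub (((hasDerivAt_id x).mul_const (Real.exp (m * τ))).mul hp)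
    have hf : (fun x => v t x) = fun x => K * N (-((Real.log (x / K) + (m - β ^ 2 / 2) * τ) / s))
        - x * Real.exp (m * τ) * N (-((Real.log (x / K) + (m + β ^ 2 / 2) * τ) / s)) := by
      funext x
      rw [hv, hdm, hdp]
    rw [hf, hdp]
    have key : K * φ (-((Real.log (x / K) + (m - β ^ 2 / 2) * τ) / s)) =
        x * Real.exp (m * τ) * φ (-((Real.log (x / K) + (m + β ^ 2 / 2) * τ) / s)) := by
      have hxK : x = K * Real.exp (Real.log (x / K)) := by
        rw [Real.exp_log (by positivity)]; field_simp
      simp only [hφ]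
      generalize Real.log (x / K) = L at hxK
      have e : Real.exp (-(-((L + (m - β ^ 2 / 2) * τ) / s)) ^ 2 / 2) =
          Real.exp L * Real.exp (m * τ) * Real.exp (-(-((L + (m + β ^ 2 / 2) * τ) / s)) ^ 2 / 2) := by
        rw [← Real.exp_add, ← Real.exp_add]
        congr 1
        rw [neg_sq, neg_sq, div_pow, div_pow, hs2]
        field_simp
        ring
      rw [e, hxK]
      ring
    refine h.congr_deriv ?_
    simp only [Function.comp, id]
    linear_combination (-(x⁻¹ / s)) * key
  refine MonotoneOn.convexOn_of_deriv (convex_Ioi 0)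
    (fun x hx => (hV x hx).continuousAt.continuousWithinAt) ?_ ?_
  · rw [interior_Ioi]
    exact fun x hx => (hV x hx).differentiableAt.differentiableWithinAt
  · rw [interior_Ioi]
    intro x hx y hy hxy
    have hx' : 0 < x := hx
    rw [(hV x hx).deriv, (hV y hy).deriv]
    have : N (-(dp t y)) ≤ N (-(dp t x)) := by
      apply hNm
      rw [hdp, hdp]
      gcongr
    gcongr
end

section
/- Fix K > 0, β > 0, m ∈ ℝ and T > 0, and let v(t,x) := K·N(−d₋(t,x)) − x·e^{m(T−t)}·N(−d₊(t,x)) with d±(t,x) := (ln(x/K) + (m ± β²/2)(T−t)) / (β√(T−t)) and N the standard normal cumulative distribution function. Then for every x > 0, v(t,x) converges to max(K − x, 0) as t tends to T from below. -/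
open Filter Topology MeasureTheory ProbabilityTheory in
theorem N_facts (N : ℝ → ℝ)
    (hN : ∀ u : ℝ, N u = ∫ y in Set.Iic u, (Real.sqrt (2 * Real.pi))⁻¹ * Real.exp (-y ^ 2 / 2)) :
    Tendsto N atBot (𝓝 0) ∧ Tendsto N atTop (𝓝 1) ∧ Continuous N := by
  have hpdf : ∀ y : ℝ, gaussianPDFReal 0 1 y
      = (Real.sqrt (2 * Real.pi))⁻¹ * Real.exp (-y ^ 2 / 2) := by
    intro y; simp [gaussianPDFReal]
  have hint : Integrable (fun y : ℝ => (Real.sqrt (2 * Real.pi))⁻¹ * Real.exp (-y ^ 2 / 2)) := by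
    have := integrable_gaussianPDFReal 0 1
    rwa [show gaussianPDFReal 0 1 = _ from funext hpdf] at this
  have hc : N = cdf (gaussianReal 0 1) := by
    funext u
    rw [hN, cdf_eq_real, Measure.real, gaussianReal_apply_eq_integral _ one_ne_zero,
      ENNReal.toReal_ofReal]
    · simp_rw [hpdf]
    · exact integral_nonneg fun y => gaussianPDFReal_nonneg _ _ _
  refine ⟨hc ▸ tendsto_cdf_atBot _, hc ▸ tendsto_cdf_atTop _, ?_⟩
  have h2 : N = fun u => N 0 + ∫ y in (0:ℝ)..u,
      (Real.sqrt (2 * Real.pi))⁻¹ * Real.exp (-y ^ 2 / 2) := by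
    funext u
    rw [← intervalIntegral.integral_Iic_sub_Iic hint.integrableOn hint.integrableOn, ← hN, ← hN]
    ring
  rw [h2]
  exact continuous_const.add (intervalIntegral.continuous_primitive
    (fun a b => hint.intervalIntegrable) 0)

open Filter Topology in
theorem d_facts (β T : ℝ) (hβ : 0 < β) (L c : ℝ) :
    (L < 0 → Tendsto (fun t => -((L + c * (T - t)) / (β * Real.sqrt (T - t)))) (𝓝[<] T) atTop) ∧
    (0 < L → Tendsto (fun t => -((L + c * (T - t)) / (β * Real.sqrt (T - t)))) (𝓝[<] T) atBot) ∧
    (L = 0 → Tendsto (fun t => -((L + c * (T - t)) / (β * Real.sqrt (T - t)))) (𝓝[<] T) (𝓝 0)) := by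
  have hn : Tendsto (fun t => -(L + c * (T - t))) (𝓝[<] T) (𝓝 (-L)) := by
    have : Continuous (fun t => -(L + c * (T - t))) := by fun_prop
    have h := this.tendsto T
    simp only [sub_self, mul_zero, add_zero] at h
    exact h.mono_left nhdsWithin_le_nhds
  have hd0 : Tendsto (fun t => β * Real.sqrt (T - t)) (𝓝[<] T) (𝓝 0) := by
    have : Continuous (fun t => β * Real.sqrt (T - t)) := by fun_prop
    have h := this.tendsto T
    simp only [sub_self, mul_zero, Real.sqrt_zero] at h
    exact h.mono_left nhdsWithin_le_nhds
  have hd : Tendsto (fun t => (β * Real.sqrt (T - t))⁻¹) (𝓝[<] T) atTop := by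
    apply Tendsto.inv_tendsto_nhdsGT_zero
    refine tendsto_nhdsWithin_iff.2 ⟨hd0, ?_⟩
    filter_upwards [self_mem_nhdsWithin] with t ht
    exact mul_pos hβ (Real.sqrt_pos.2 (sub_pos.2 ht))
  have e : (fun t => -((L + c * (T - t)) / (β * Real.sqrt (T - t))))
      = fun t => -(L + c * (T - t)) * (β * Real.sqrt (T - t))⁻¹ := by
    funext t; rw [div_eq_mul_inv]; ring
  refine ⟨fun h => ?_, fun h => ?_, fun h => ?_⟩
  · rw [e]; exact hn.pos_mul_atTop (by linarith) hd
  · rw [e]; exact hn.neg_mul_atTop (by linarith) hd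
  · subst h
    have h3 := hd0.const_mul (-c / β ^ 2)
    rw [mul_zero] at h3
    refine h3.congr' ?_
    filter_upwards [self_mem_nhdsWithin] with t ht
    have hs := Real.sqrt_pos.2 (sub_pos.2 ht)
    have hq := Real.sq_sqrt (sub_pos.2 ht).le
    generalize Real.sqrt (T - t) = s at *
    rw [← hq]
    field_simp
    ring

theorem stmt17 (K β m T : ℝ) (hK : 0 < K) (hβ : 0 < β) (hT : 0 < T)
    (N : ℝ → ℝ)
    (hN : ∀ u : ℝ, N u = ∫ y in Set.Iic u, (Real.sqrt (2 * Real.pi))⁻¹ * Real.exp (-y ^ 2 / 2))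
    (dp dm : ℝ → ℝ → ℝ)
    (hdp : ∀ t x, dp t x = (Real.log (x / K) + (m + β ^ 2 / 2) * (T - t)) / (β * Real.sqrt (T - t)))
    (hdm : ∀ t x, dm t x = (Real.log (x / K) + (m - β ^ 2 / 2) * (T - t)) / (β * Real.sqrt (T - t)))
    (v : ℝ → ℝ → ℝ)
    (hv : ∀ t x, v t x = K * N (-(dm t x)) - x * Real.exp (m * (T - t)) * N (-(dp t x))) :
    ∀ x : ℝ, 0 < x →
      Filter.Tendsto (fun t => v t x) (nhdsWithin T (Set.Iio T)) (nhds (max (K - x) 0)) := by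
  intro x hx
  obtain ⟨hb, ht, hc⟩ := N_facts N hN
  have he : Filter.Tendsto (fun t => x * Real.exp (m * (T - t))) (nhdsWithin T (Set.Iio T))
      (nhds x) := by
    have : Continuous (fun t => x * Real.exp (m * (T - t))) := by fun_prop
    have h := this.tendsto T
    simp only [sub_self, mul_zero, Real.exp_zero, mul_one] at h
    exact h.mono_left nhdsWithin_le_nhds
  obtain ⟨p1, p2, p3⟩ := d_facts β T hβ (Real.log (x / K)) (m + β ^ 2 / 2)
  obtain ⟨q1, q2, q3⟩ := d_facts β T hβ (Real.log (x / K)) (m - β ^ 2 / 2)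
  simp only [hv, hdp, hdm]
  rcases lt_trichotomy x K with h | h | h
  · have hL : Real.log (x / K) < 0 := Real.log_neg (by positivity) ((div_lt_one hK).2 h)
    have := ((ht.comp (q1 hL)).const_mul K).sub (he.mul (ht.comp (p1 hL)))
    rw [max_eq_left (by linarith)]
    simpa using this
  · have hL : Real.log (x / K) = 0 := by rw [h, div_self hK.ne', Real.log_one]
    have := (((hc.tendsto 0).comp (q3 hL)).const_mul K).sub (he.mul ((hc.tendsto 0).comp (p3 hL)))
    rw [h] at this ⊢
    simpa using this
  · have hL : 0 < Real.log (x / K) := Real.log_pos ((one_lt_div hK).2 h)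
    have := ((hb.comp (q2 hL)).const_mul K).sub (he.mul (hb.comp (p2 hL)))
    rw [max_eq_right (by linarith)]
    simpa using this
end
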